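/- arXiv:1210.7593 — 2 statements merged into one kernel-verified Lean document; each statement's English description precedes it below -/
import Mathlib

section
/- Let A be a positive integer and A* its base-10 reversal. If (A, A*) is a polynomial pair, then the maximum base-10 digit of the product A × A* equals the sum of the squares of the base-10 digits of A, i.e., (A × A*)_∞ = ∑_i a_i², where a_i are the base-10 digits of A. -/
/-- The `i`-th base-10 digit of `N` (0 if out of range). -/
def digit (N i : ℕ) : ℕ := (Nat.digits 10 N).getD i 0

/-- The polynomial whose coefficient of `X ^ i` is the `i`-th base-10 digit of `N`. -/
noncomputable def digitPoly (N : ℕ) : Polynomial ℕ :=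
  ∑ i ∈ Finset.range (Nat.digits 10 N).length, Polynomial.C (digit N i) * Polynomial.X ^ i

/-- The base-10 reversal of `N`. -/
def rev (N : ℕ) : ℕ := Nat.ofDigits 10 (Nat.digits 10 N).reverse

/-- The multiplication of `A` by `B` can be performed without carry in base 10:
every convolution sum of digits is at most 9. -/
def NoCarryMul (A B : ℕ) : Prop :=
  ∀ k, ∑ i ∈ Finset.range (k + 1), digit A i * digit B (k - i) ≤ 9

/-- The maximum base-10 digit of `N`. -/
def maxDigit (N : ℕ) : ℕ := (Nat.digits 10 N).foldr max 0

/-- The sum of the base-10 digits of `N`. -/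
def digitSum (N : ℕ) : ℕ := (Nat.digits 10 N).sum

/-- The `i`-th base-`b` digit of `N` (0 if out of range). -/
def digitB (b N i : ℕ) : ℕ := (Nat.digits b N).getD i 0

/-- The base-`b` reversal of `N`. -/
def revB (b N : ℕ) : ℕ := Nat.ofDigits b (Nat.digits b N).reverse

/-- The multiplication of `A` by `B` can be performed without carry in base `b`:
every convolution sum of base-`b` digits is at most `b - 1`. -/
def NoCarryMulB (b A B : ℕ) : Prop :=
  ∀ k, ∑ i ∈ Finset.range (k + 1), digitB b A i * digitB b B (k - i) ≤ b - 1

open Polynomial in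
theorem eval_div_pow_mod_eq_coeff {b : ℕ} (k : ℕ) (p : ℕ[X]) (hp : ∀ i, p.coeff i < b) :
    p.eval b / b ^ k % b = p.coeff k := by
  have hb : 0 < b := (Nat.zero_le _).trans_lt (hp 0)
  have hev : p.eval b = p.coeff 0 + b * p.divX.eval b := by
    conv_lhs => rw [← p.divX_mul_X_add]
    simp only [eval_add, eval_mul, eval_X, eval_C]
    ring
  induction k generalizing p with
  | zero =>
    rw [hev, pow_zero, Nat.div_one, Nat.add_mul_mod_self_left, Nat.mod_eq_of_lt (hp 0)]
  | succ k ih =>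
    have hdiv : p.eval b / b = p.divX.eval b := by
      rw [hev, Nat.add_mul_div_left _ _ hb, Nat.div_eq_of_lt (hp 0), zero_add]
    rw [pow_succ', ← Nat.div_div_eq_div_mul, hdiv, ih p.divX, coeff_divX]
    · intro i
      rw [coeff_divX]
      exact hp _
    · conv_lhs => rw [← p.divX.divX_mul_X_add]
      simp only [eval_add, eval_mul, eval_X, eval_C]
      ring

open Polynomial in
theorem coeff_ofDigits_X (L : List ℕ) (k : ℕ) :
    (Nat.ofDigits (X : ℕ[X]) L).coeff k = L.getD k 0 := by
  induction L generalizing k with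
  | nil => simp [Nat.ofDigits]
  | cons a L ih =>
    rw [Nat.ofDigits, coeff_add, coeff_natCast_ite]
    cases k with
    | zero => simp
    | succ k => rw [coeff_X_mul, ih]; simp

open Polynomial in
theorem eval_ofDigits_X (b : ℕ) (L : List ℕ) :
    (Nat.ofDigits (X : ℕ[X]) L).eval b = Nat.ofDigits b L := by
  induction L with
  | nil => simp [Nat.ofDigits]
  | cons a L ih => simp [Nat.ofDigits, ih]

theorem digit_eval (p : Polynomial ℕ) (hp : ∀ i, p.coeff i ≤ 9) (k : ℕ) :
    digit (p.eval 10) k = p.coeff k := by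
  rw [digit, Nat.getD_digits _ _ (by norm_num)]
  exact eval_div_pow_mod_eq_coeff (b := 10) k p fun i => Nat.lt_succ_of_le (hp i)

theorem digit_ofDigits (L : List ℕ) (hL : ∀ d ∈ L, d ≤ 9) (k : ℕ) :
    digit (Nat.ofDigits 10 L) k = L.getD k 0 := by
  have h := digit_eval (Nat.ofDigits Polynomial.X L) (fun i => ?_) k
  · rwa [coeff_ofDigits_X, eval_ofDigits_X 10] at h
  · rw [coeff_ofDigits_X]
    rcases lt_or_ge i L.length with hi | hi
    · rw [List.getD_eq_getElem _ _ hi]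
      exact hL _ (List.getElem_mem hi)
    · exact (List.getD_eq_default _ _ hi).trans_le (Nat.zero_le _)

theorem digit_mul_of_noCarryMul {A B : ℕ} (h : NoCarryMul A B) (k : ℕ) :
    digit (A * B) k = ∑ i ∈ Finset.range (k + 1), digit A i * digit B (k - i) := by
  have hcoeff (j : ℕ) : (Nat.ofDigits (Polynomial.X : Polynomial ℕ) (Nat.digits 10 A) *
      Nat.ofDigits Polynomial.X (Nat.digits 10 B)).coeff j =
      ∑ i ∈ Finset.range (j + 1), digit A i * digit B (j - i) := by
    simp only [Polynomial.coeff_mul, Finset.Nat.sum_antidiagonal_eq_sum_range_succ_mk,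
      coeff_ofDigits_X, digit]
  have hd := digit_eval _ (fun j => (hcoeff j).trans_le (h j)) k
  rw [hcoeff, Polynomial.eval_mul, eval_ofDigits_X 10, eval_ofDigits_X 10, Nat.ofDigits_digits,
    Nat.ofDigits_digits] at hd
  exact hd

theorem foldr_max_le_iff (L : List ℕ) (M : ℕ) :
    L.foldr max 0 ≤ M ↔ ∀ k, L.getD k 0 ≤ M := by
  induction L with
  | nil => simp
  | cons a L ih =>
    rw [List.foldr_cons, max_le_iff, ih]
    refine ⟨fun h k => ?_, fun h => ⟨h 0, fun k => h (k + 1)⟩⟩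
    cases k with
    | zero => exact h.1
    | succ k => exact h.2 k

theorem maxDigit_le_iff {N M : ℕ} : maxDigit N ≤ M ↔ ∀ k, digit N k ≤ M :=
  foldr_max_le_iff _ _

theorem sum_range_length_getD_sq (L : List ℕ) :
    ∑ i ∈ Finset.range L.length, L.getD i 0 ^ 2 = (L.map (· ^ 2)).sum := by
  induction L with
  | nil => simp
  | cons a L ih =>
    rw [List.length_cons, Finset.sum_range_succ', List.map_cons, List.sum_cons, ← ih, add_comm]
    simp

theorem sum_range_getD_sq_le (L : List ℕ) (m : ℕ) :
    ∑ i ∈ Finset.range m, L.getD i 0 ^ 2 ≤ (L.map (· ^ 2)).sum := by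
  rw [← sum_range_length_getD_sq]
  refine Finset.sum_le_sum_of_ne_zero fun i _ hi => ?_
  rw [Finset.mem_range]
  by_contra! hlt
  exact hi (by rw [List.getD_eq_default _ _ hlt, zero_pow two_ne_zero])

theorem sum_mul_getD_reverse_le (L : List ℕ) (k : ℕ) :
    ∑ i ∈ Finset.range (k + 1), L.getD i 0 * L.reverse.getD (k - i) 0 ≤
      (L.map (· ^ 2)).sum := by
  have h₁ := sum_range_getD_sq_le L (k + 1)
  have h₂ := sum_range_getD_sq_le L.reverse (k + 1)
  rw [← Finset.sum_range_reflect, List.map_reverse, List.sum_reverse] at h₂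
  have h₃ : 2 * ∑ i ∈ Finset.range (k + 1), L.getD i 0 * L.reverse.getD (k - i) 0 ≤
      ∑ i ∈ Finset.range (k + 1), L.getD i 0 ^ 2 +
        ∑ i ∈ Finset.range (k + 1), L.reverse.getD (k + 1 - 1 - i) 0 ^ 2 := by
    rw [Finset.mul_sum, ← Finset.sum_add_distrib]
    refine Finset.sum_le_sum fun i _ => ?_
    rw [← mul_assoc]
    exact two_mul_le_add_sq _ _
  omega

theorem sum_mul_getD_reverse_eq {L : List ℕ} (hL : 0 < L.length) :
    ∑ i ∈ Finset.range (L.length - 1 + 1), L.getD i 0 * L.reverse.getD (L.length - 1 - i) 0 =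
      (L.map (· ^ 2)).sum := by
  rw [Nat.sub_add_cancel hL, ← sum_range_length_getD_sq]
  refine Finset.sum_congr rfl fun i hi => ?_
  rw [Finset.mem_range] at hi
  rw [List.getD_eq_getElem _ _ hi, List.getD_eq_getElem _ _ (by rw [List.length_reverse]; omega),
    List.getElem_reverse, sq]
  congr 2
  omega

/-- if `(A, A*)` is a polynomial pair, then the maximum base-10 digit
of `A × A*` equals the sum of the squares of the base-10 digits of `A`. -/
theorem stmt12 (A : ℕ) (hA : 0 < A) (h : NoCarryMul A (rev A)) :
    maxDigit (A * rev A) = ((Nat.digits 10 A).map (· ^ 2)).sum := by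
  have hrev (j : ℕ) : digit (rev A) j = (Nat.digits 10 A).reverse.getD j 0 :=
    digit_ofDigits _ (fun d hd =>
      Nat.le_of_lt_succ (Nat.digits_lt_base (by norm_num) (List.mem_reverse.mp hd))) j
  have hmul (k : ℕ) : digit (A * rev A) k = ∑ i ∈ Finset.range (k + 1),
      (Nat.digits 10 A).getD i 0 * (Nat.digits 10 A).reverse.getD (k - i) 0 := by
    simp only [digit_mul_of_noCarryMul h, hrev]
    rfl
  have hlen : 0 < (Nat.digits 10 A).length :=
    List.length_pos_iff.mpr (Nat.digits_ne_nil_iff_ne_zero.mpr hA.ne')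
  refine le_antisymm (maxDigit_le_iff.mpr fun k => ?_) ?_
  · rw [hmul]
    exact sum_mul_getD_reverse_le _ k
  · rw [← sum_mul_getD_reverse_eq hlen, ← hmul]
    exact maxDigit_le_iff.mp le_rfl _
end

section
/- If A is a positive integer that is a base-10 palindrome and (A, A) is a polynomial pair, then A² is a palindrome. -/
theorem coeff_digitPoly (N i : ℕ) : (digitPoly N).coeff i = digit N i := by
  simp only [digitPoly, Polynomial.finsetSum_coeff, Polynomial.coeff_C_mul_X_pow,
    Finset.sum_ite_eq, Finset.mem_range]
  split_ifs with h
  · rfl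
  · simp [digit, List.getElem?_eq_none (not_lt.mp h)]

theorem ofDigits_map_range (b n : ℕ) (f : ℕ → ℕ) :
    Nat.ofDigits b ((List.range n).map f) = ∑ i ∈ Finset.range n, f i * b ^ i := by
  induction n with
  | zero => simp
  | succ n ih =>
    rw [List.range_succ, List.map_append, Nat.ofDigits_append, ih, Finset.sum_range_succ]
    simp [mul_comm]

theorem map_digit_range (N : ℕ) :
    (List.range (Nat.digits 10 N).length).map (digit N) = Nat.digits 10 N := by
  apply List.ext_getElem
  · simp
  · intro i _ h
    simp [digit, h]

theorem eval_digitPoly (N : ℕ) : (digitPoly N).eval 10 = N := by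
  have h := ofDigits_map_range 10 (Nat.digits 10 N).length (digit N)
  rw [map_digit_range, Nat.ofDigits_digits] at h
  simp [digitPoly, Polynomial.eval_finsetSum, ← h]

theorem natDegree_digitPoly {N : ℕ} (hN : N ≠ 0) :
    (digitPoly N).natDegree = (Nat.digits 10 N).length - 1 := by
  apply Polynomial.natDegree_eq_of_le_of_coeff_ne_zero
  · rw [Polynomial.natDegree_le_iff_coeff_eq_zero]
    intro i hi
    have : (Nat.digits 10 N).length ≤ i := by omega
    simp [coeff_digitPoly, digit, List.getElem?_eq_none this]
  · have h := Nat.getLast_digit_ne_zero 10 hN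
    have hl := List.length_pos_of_ne_nil (Nat.digits_ne_nil_iff_ne_zero (b := 10) |>.mpr hN)
    rw [List.getLast_eq_getElem] at h
    rw [coeff_digitPoly, digit, List.getD_eq_getElem _ _ (by omega)]
    exact h

theorem reverse_digits_of_rev_eq {N : ℕ} (h : rev N = N) :
    (Nat.digits 10 N).reverse = Nat.digits 10 N := by
  refine Nat.ofDigits_inj_of_len_eq (b := 10) (by norm_num) (by simp) ?_ ?_ ?_
  · exact fun l hl => Nat.digits_lt_base (by norm_num) (List.mem_reverse.mp hl)
  · exact fun l hl => Nat.digits_lt_base (by norm_num) hl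
  · rw [Nat.ofDigits_digits]
    exact h

theorem reverse_digitPoly {N : ℕ} (hN : N ≠ 0) (h : rev N = N) :
    (digitPoly N).reverse = digitPoly N := by
  ext i
  rw [Polynomial.coeff_reverse, natDegree_digitPoly hN]
  rcases le_or_gt i ((Nat.digits 10 N).length - 1) with hi | hi
  · have hl := List.length_pos_of_ne_nil (Nat.digits_ne_nil_iff_ne_zero (b := 10) |>.mpr hN)
    have hlt : i < (Nat.digits 10 N).length := by omega
    have hr : (Nat.digits 10 N).reverse.getD i 0 = (Nat.digits 10 N).getD i 0 := by
      rw [reverse_digits_of_rev_eq h]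
    rw [Polynomial.revAt_le hi, coeff_digitPoly, coeff_digitPoly, digit, digit, ← hr,
      List.getD_eq_getElem _ _ (by omega), List.getD_eq_getElem _ _ (by simpa using hlt),
      List.getElem_reverse]
  · rw [Polynomial.revAt_eq_self_of_lt hi]

theorem digits_eval {Q : Polynomial ℕ} (hQ : Q ≠ 0) {b : ℕ} (hb : 1 < b)
    (h : ∀ k, Q.coeff k < b) :
    Nat.digits b (Q.eval b) = (List.range (Q.natDegree + 1)).map Q.coeff := by
  rw [Polynomial.eval_eq_sum_range, ← ofDigits_map_range]
  apply Nat.digits_ofDigits b hb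
  · intro l hl
    obtain ⟨k, -, rfl⟩ := List.mem_map.mp hl
    exact h k
  · intro _
    simpa [List.getLast_eq_getElem] using hQ

theorem reverse_map_coeff_range {Q : Polynomial ℕ} (h : Q.reverse = Q) :
    ((List.range (Q.natDegree + 1)).map Q.coeff).reverse =
      (List.range (Q.natDegree + 1)).map Q.coeff := by
  apply List.ext_getElem
  · simp
  · intro i _ hi
    have hi' : i ≤ Q.natDegree := by simpa [Nat.lt_succ_iff] using hi
    have hc := congrArg (fun P => P.coeff i) h
    simpa [Polynomial.coeff_reverse, Polynomial.revAt_le hi', List.getElem_reverse] using hc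

/-- if `A` is a palindrome and `(A, A)` is a polynomial pair, then `A²`
is a palindrome. -/
theorem stmt16 (A : ℕ) (hA : 0 < A) (hpal : rev A = A) (h : NoCarryMul A A) :
    rev (A ^ 2) = A ^ 2 := by
  have hN := hA.ne'
  have h0 : digitPoly A ≠ 0 := by
    intro h0
    have := eval_digitPoly A
    simp [h0] at this
    omega
  have hQ : (digitPoly A * digitPoly A).reverse = digitPoly A * digitPoly A := by
    rw [Polynomial.reverse_mul_of_domain, reverse_digitPoly hN hpal]
  have hlt : ∀ k, (digitPoly A * digitPoly A).coeff k < 10 := by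
    intro k
    rw [Polynomial.coeff_mul, Finset.Nat.sum_antidiagonal_eq_sum_range_succ_mk]
    simp only [coeff_digitPoly]
    exact Nat.lt_succ_of_le (h k)
  have hd := digits_eval (mul_ne_zero h0 h0) (by norm_num) hlt
  have he : (digitPoly A * digitPoly A).eval 10 = A ^ 2 := by
    rw [Polynomial.eval_mul, eval_digitPoly, sq]
  rw [he] at hd
  rw [rev, hd, reverse_map_coeff_range hQ, ← hd, Nat.ofDigits_digits]
end
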